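/- Let the standing assumptions hold with, in addition: each f_i is ρ-weakly convex for some ρ ≥ 0 (i.e. f_i + ρ‖·‖² is convex), D_i := ∂f_i is its subdifferential defined by ∂f_i(x) := {v : ∀ y, f_i(y) ≥ f_i(x) + ⟨v, y − x⟩ − ρ‖y − x‖²} (this set-valued map is assumed to be a locally bounded conservative field for f_i with nonempty convex values), and Φ is weakly convex. Let δ, ε > 0. Then for every x₀ ∈ dom Φ there exists T₀ ≥ 0 such that for every T ≥ T₀ there exists ᾱ > 0 such that every proximal-random-reshuffling sequence (x_k) initialized at x₀ with step sizes α_k ∈ (0, ᾱ] and Σ_{k=0}^∞ α_k = T converges to a limit x* that is (ε,δ)-near approximate D_Φ-stationary, i.e. inf{‖v‖ : v ∈ D_Φ(y) for some y with ‖y − x*‖ ≤ ε} ≤ δ. -/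

import Mathlib

open scoped RealInnerProductSpace
open MeasureTheory

noncomputable section

/-- Euclidean space ℝ^d. -/
abbrev Euc (d : ℕ) := EuclideanSpace ℝ (Fin d)

/-- Convex subdifferential of an extended-real-valued function. -/
def Subdiff {d : ℕ} (g : Euc d → EReal) (x : Euc d) : Set (Euc d) :=
  {v | ∀ y : Euc d, g x + ((⟪v, y - x⟫ : ℝ) : EReal) ≤ g y}

/-- Proper: somewhere finite and never −∞. -/
def ProperFn {d : ℕ} (g : Euc d → EReal) : Prop :=
  (∃ x, g x ≠ ⊤) ∧ ∀ x, g x ≠ ⊥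

/-- Convexity via the epigraph. -/
def ConvexFn {d : ℕ} (g : Euc d → EReal) : Prop :=
  Convex ℝ {p : Euc d × ℝ | g p.1 ≤ (p.2 : EReal)}

/-- Locally Lipschitz on the domain `{x | g x ≠ ⊤}`. -/
def LocLipOnDom {d : ℕ} (g : Euc d → EReal) : Prop :=
  ∀ x : Euc d, g x ≠ ⊤ → ∃ ε > (0:ℝ), ∃ K : ℝ, ∀ y : Euc d, g y ≠ ⊤ → ∀ z : Euc d, g z ≠ ⊤ →
    ‖y - x‖ ≤ ε → ‖z - x‖ ≤ ε → |(g y).toReal - (g z).toReal| ≤ K * ‖y - z‖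

/-- A set-valued map is locally bounded. -/
def LocBounded {d : ℕ} (F : Euc d → Set (Euc d)) : Prop :=
  ∀ x : Euc d, ∃ ε > (0:ℝ), Bornology.IsBounded (⋃ y ∈ Metric.ball x ε, F y)

/-- `D` is a conservative field for the locally Lipschitz function `f : ℝ^d → ℝ`. -/
def IsConservativeFieldR {d : ℕ} (D : Euc d → Set (Euc d)) (f : Euc d → ℝ) : Prop :=
  IsClosed {p : Euc d × Euc d | p.2 ∈ D p.1} ∧
  ∀ x u : ℝ → Euc d, IntervalIntegrable u volume 0 1 →
    (∀ t ∈ Set.Icc (0:ℝ) 1, x t = x 0 + ∫ s in (0:ℝ)..t, u s) →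
    (∀ t ∈ Set.Icc (0:ℝ) 1, (D (x t)).Nonempty) →
    ∀ᵐ t ∂volume, t ∈ Set.Ioo (0:ℝ) 1 →
      ∀ v ∈ D (x t), HasDerivAt (fun s => f (x s)) (⟪v, u t⟫ : ℝ) t

/-- The objective `Φ = f₁ + ⋯ + f_N + g`. -/
def Phi {d : ℕ} (N : ℕ) (f : Fin N → Euc d → ℝ) (g : Euc d → EReal) (x : Euc d) : EReal :=
  ((∑ i, f i x : ℝ) : EReal) + g x

/-- The field `D_Φ = D₁ + ⋯ + D_N + ∂g` (pointwise Minkowski sum). -/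
def DPhi {d : ℕ} (N : ℕ) (D : Fin N → Euc d → Set (Euc d)) (g : Euc d → EReal)
    (x : Euc d) : Set (Euc d) :=
  {w : Euc d | ∃ v : Fin N → Euc d, (∀ i, v i ∈ D i x) ∧
    ∃ s ∈ Subdiff g x, w = (∑ i, v i) + s}

/-- `(α, x)` is a proximal random reshuffling sequence: at each outer iteration `k`
there are a permutation `σ` and inner iterates `z` performing one subgradient step
for each `D_{σ(i)}` followed by a proximal step for `g`
(`x (k+1)` minimizes `w ↦ g w + ‖w − z_N‖²/(2 α_k)`). -/
def IsPRR {d : ℕ} (N : ℕ) (D : Fin N → Euc d → Set (Euc d)) (g : Euc d → EReal)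
    (α : ℕ → ℝ) (x : ℕ → Euc d) : Prop :=
  ∀ k : ℕ, ∃ (σ : Equiv.Perm (Fin N)) (z : ℕ → Euc d),
    z 0 = x k ∧
    (∀ i : Fin N, ∃ v ∈ D (σ i) (z i.1), z (i.1 + 1) = z i.1 - α k • v) ∧
    (∀ w : Euc d,
      g (x (k+1)) + ((‖x (k+1) - z N‖ ^ 2 / (2 * α k) : ℝ) : EReal) ≤
        g w + ((‖w - z N‖ ^ 2 / (2 * α k) : ℝ) : EReal))

/-- Standing assumptions of the paper: each `f_i` is locally Lipschitz, each `D_i`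
is a locally bounded conservative field for `f_i` with nonempty convex values,
`g` is proper, convex, with closed domain and locally Lipschitz on its domain,
and `Φ = f₁ + ⋯ + f_N + g` is bounded below. -/
def StandingAssumptions {d : ℕ} (N : ℕ) (f : Fin N → Euc d → ℝ)
    (D : Fin N → Euc d → Set (Euc d)) (g : Euc d → EReal) : Prop :=
  (∀ i, LocallyLipschitz (f i)) ∧
  (∀ i, IsConservativeFieldR (D i) (f i)) ∧
  (∀ i, LocBounded (D i)) ∧
  (∀ i x, (D i x).Nonempty ∧ Convex ℝ (D i x)) ∧
  ProperFn g ∧ ConvexFn g ∧ IsClosed {x : Euc d | g x ≠ ⊤} ∧ LocLipOnDom g ∧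
  ∃ c : ℝ, ∀ x : Euc d, (c : EReal) ≤ Phi N f g x

/-- The subdifferential of a `ρ`-weakly convex real-valued function:
`∂f(x) = {v : ∀ y, f(y) ≥ f(x) + ⟨v, y − x⟩ − ρ‖y − x‖²}`. -/
def WSubdiff {d : ℕ} (f : Euc d → ℝ) (ρ : ℝ) (x : Euc d) : Set (Euc d) :=
  {v : Euc d | ∀ y : Euc d, f x + (⟪v, y - x⟫ : ℝ) - ρ * ‖y - x‖ ^ 2 ≤ f y}

/-- A sequence of proximal point steps of size `h` for a `μ`-weakly convex function `F` on `C`. -/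
def IsProxSeq {E : Type*} [NormedAddCommGroup E] (C : Set E) (F : E → ℝ) (μ h : ℝ) (y : ℕ → E) :
    Prop :=
  ∀ i, y i ∈ C ∧ ∀ w ∈ C, ‖y (i + 1) - y i‖ ^ 2 + (1 - 2 * μ * h) * ‖w - y (i + 1)‖ ^ 2 ≤
    2 * h * (F w - F (y (i + 1))) + ‖w - y i‖ ^ 2

namespace IsProxSeq

variable {E : Type*} [NormedAddCommGroup E] {C : Set E} {F : E → ℝ} {μ h : ℝ} {y : ℕ → E}

lemma shift (hy : IsProxSeq C F μ h y) (k : ℕ) : IsProxSeq C F μ h (fun i => y (k + i)) :=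
  fun i => hy (k + i)

lemma descent (hy : IsProxSeq C F μ h y) (hq : 0 ≤ 1 - 2 * μ * h) (i : ℕ) :
    ‖y (i + 1) - y i‖ ^ 2 ≤ 2 * h * (F (y i) - F (y (i + 1))) := by
  have h1 := (hy i).2 _ (hy i).1
  have : 0 ≤ (1 - 2 * μ * h) * ‖y i - y (i + 1)‖ ^ 2 := by positivity
  simp only [sub_self, norm_zero] at h1
  nlinarith

lemma antitone (hy : IsProxSeq C F μ h y) (hh : 0 < h) (hq : 0 ≤ 1 - 2 * μ * h) :
    Antitone (fun i => F (y i)) := by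
  refine antitone_nat_of_succ_le fun i => ?_
  have h1 := hy.descent hq i
  have : 0 ≤ 2 * h * (F (y i) - F (y (i + 1))) := (sq_nonneg _).trans h1
  have := nonneg_of_mul_nonneg_right this (by positivity)
  linarith

lemma dist_sq_le (hy : IsProxSeq C F μ h y) (hq : 0 ≤ 1 - 2 * μ * h) (m : ℕ) :
    ‖y m - y 0‖ ^ 2 ≤ 2 * (h * m) * (F (y 0) - F (y m)) := by
  have h1 : ‖y m - y 0‖ ≤ ∑ i ∈ Finset.range m, ‖y (i + 1) - y i‖ := by
    rw [← Finset.sum_range_sub]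
    exact norm_sum_le _ _
  have h2 : ∑ i ∈ Finset.range m, ‖y (i + 1) - y i‖ ^ 2 ≤ 2 * h * (F (y 0) - F (y m)) := by
    rw [← Finset.sum_range_sub' (fun i => F (y i)), Finset.mul_sum]
    exact Finset.sum_le_sum fun i _ => hy.descent hq i
  calc ‖y m - y 0‖ ^ 2 ≤ (∑ i ∈ Finset.range m, ‖y (i + 1) - y i‖) ^ 2 := by gcongr
    _ ≤ m * ∑ i ∈ Finset.range m, ‖y (i + 1) - y i‖ ^ 2 := by
      simpa using sq_sum_le_card_mul_sum_sq (s := Finset.range m)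
        (f := fun i => ‖y (i + 1) - y i‖)
    _ ≤ m * (2 * h * (F (y 0) - F (y m))) := by gcongr
    _ = _ := by ring

/-- Discrete evolution variational inequality for the proximal point sequence. -/
lemma evi (hy : IsProxSeq C F μ h y) (hh : 0 < h) (hμ : 0 ≤ μ) (hq : 0 ≤ 1 - 2 * μ * h)
    (m : ℕ) {w : E} (hw : w ∈ C) :
    (1 - 2 * μ * (h * m)) * ‖w - y m‖ ^ 2 ≤ ‖w - y 0‖ ^ 2 + 2 * (h * m) * (F w - F (y m)) +
      4 * μ * (h * m) ^ 2 * |F w - F (y m)| := by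
  set q := 1 - 2 * μ * h with hqdef
  have hq1 : q ≤ 1 := by
    have : 0 ≤ 2 * μ * h := by positivity
    linarith
  have hpow : ∀ i : ℕ, 1 - 2 * μ * (h * i) ≤ q ^ i := fun i => by
    have := one_add_mul_le_pow (a := -(2 * μ * h)) (by linarith) i
    rw [show 1 + -(2 * μ * h) = q by ring] at this
    linarith
  have key : ∀ A : ℝ, ∀ m : ℕ, (∀ i < m, F w - F (y (i + 1)) ≤ A) →
      q ^ m * ‖w - y m‖ ^ 2 ≤ ‖w - y 0‖ ^ 2 + 2 * h * A * ∑ i ∈ Finset.range m, q ^ i := by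
    intro A m
    induction m with
    | zero => simp
    | succ m ih =>
      intro hA
      have h1 := ih fun i hi => hA i (by omega)
      have h2 := (hy m).2 w hw
      have h3 := hA m (by omega)
      have h4 : q * ‖w - y (m + 1)‖ ^ 2 ≤ 2 * h * A + ‖w - y m‖ ^ 2 := by
        have : 2 * h * (F w - F (y (m + 1))) ≤ 2 * h * A := by gcongr
        have : 0 ≤ ‖y (m + 1) - y m‖ ^ 2 := by positivity
        linarith
      have h5 := mul_le_mul_of_nonneg_left h4 (pow_nonneg hq m)
      rw [Finset.sum_range_succ, pow_succ]
      linarith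
  have h1 := key (F w - F (y m)) m fun i hi => by
    have := hy.antitone hh hq (show i + 1 ≤ m by omega)
    simp only at this
    linarith
  have h2 : ∑ i ∈ Finset.range m, q ^ i ≤ m := by
    simpa using Finset.sum_le_card_nsmul (Finset.range m) (fun i => q ^ i) 1
      (fun i _ => pow_le_one₀ hq hq1)
  have h3 : m * (1 - 2 * μ * (h * m)) ≤ ∑ i ∈ Finset.range m, q ^ i := by
    have := Finset.card_nsmul_le_sum (Finset.range m) (fun i => q ^ i) (1 - 2 * μ * (h * m))
      (fun i hi => by
        refine le_trans ?_ (hpow i)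
        have : (i : ℝ) ≤ m := by exact_mod_cast (Finset.mem_range.1 hi).le
        gcongr)
    simpa using this
  have h4 := mul_le_mul_of_nonneg_right (hpow m) (sq_nonneg ‖w - y m‖)
  have h5 : 2 * h * (F w - F (y m)) * ∑ i ∈ Finset.range m, q ^ i ≤
      2 * (h * m) * (F w - F (y m)) + 4 * μ * (h * m) ^ 2 * |F w - F (y m)| := by
    rcases le_total 0 (F w - F (y m)) with hA | hA
    · have := mul_le_mul_of_nonneg_left h2 (by positivity : 0 ≤ 2 * h * (F w - F (y m)))
      have : 0 ≤ 4 * μ * (h * m) ^ 2 * |F w - F (y m)| := by positivity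
      linarith
    · rw [abs_of_nonpos hA]
      have := mul_le_mul_of_nonneg_left h3
        (by have := neg_nonneg.2 hA; positivity : 0 ≤ 2 * h * (-(F w - F (y m))))
      linarith
  linarith

end IsProxSeq

/-- `X` is a curve in `C` satisfying the evolution variational inequality of the `μ`-weakly convex
function `F`. -/
structure IsEVICurve {E : Type*} [NormedAddCommGroup E] (C : Set E) (F : E → ℝ) (μ : ℝ)
    (X : ℝ → E) : Prop where
  mem : ∀ t, 0 ≤ t → X t ∈ C
  dist_sq_le : ∀ s t, 0 ≤ s → s ≤ t → ‖X t - X s‖ ^ 2 ≤ 2 * (t - s) * (F (X s) - F (X t))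
  le : ∀ s t, 0 ≤ s → s ≤ t → F (X t) ≤ F (X s)
  evi : ∀ s t, 0 ≤ s → s ≤ t → ∀ w ∈ C,
    (1 - 2 * μ * (t - s)) * ‖w - X t‖ ^ 2 ≤ ‖w - X s‖ ^ 2 +
      2 * (t - s) * (F w - F (X t)) + 4 * μ * (t - s) ^ 2 * |F w - F (X t)|

section HilbertLemmas

variable {E : Type*} [NormedAddCommGroup E] [InnerProductSpace ℝ E]

lemma norm_sq_convex_combination (x y : E) {a b : ℝ} (hab : a + b = 1) :
    ‖a • x + b • y‖ ^ 2 = a * ‖x‖ ^ 2 + b * ‖y‖ ^ 2 - a * b * ‖x - y‖ ^ 2 := by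
  rw [norm_add_sq_real, norm_sub_sq_real, norm_smul, norm_smul, mul_pow, mul_pow,
    inner_smul_left, inner_smul_right, Real.norm_eq_abs, Real.norm_eq_abs, sq_abs, sq_abs]
  obtain rfl : b = 1 - a := by linarith
  simp only [conj_trivial]
  ring

lemma convexOn_finset_sum {ι : Type*} {C : Set E} {φ : ι → E → ℝ} (hC : Convex ℝ C)
    (S : Finset ι) (hφ : ∀ i ∈ S, ConvexOn ℝ C (φ i)) :
    ConvexOn ℝ C (fun x => ∑ i ∈ S, φ i x) := by
  classical
  induction S using Finset.induction_on with
  | empty => simpa using convexOn_const (0 : ℝ) hC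
  | insert a S ha ih =>
    simp only [Finset.sum_insert ha]
    exact (hφ a (Finset.mem_insert_self a S)).add
      (ih fun i hi => hφ i (Finset.mem_insert_of_mem hi))

/-- Quadratic growth of the proximal objective of a weakly convex function at its minimizer. -/
lemma prox_quadratic_growth {C : Set E} {F : E → ℝ} {μ h : ℝ} {p y w : E} (hh : 0 < h)
    (hF : ConvexOn ℝ C (fun x => F x + μ * ‖x‖ ^ 2)) (hy : y ∈ C)
    (hmin : ∀ w ∈ C, F y + ‖y - p‖ ^ 2 / (2 * h) ≤ F w + ‖w - p‖ ^ 2 / (2 * h)) (hw : w ∈ C) :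
    ‖y - p‖ ^ 2 + (1 - 2 * μ * h) * ‖w - y‖ ^ 2 ≤ 2 * h * (F w - F y) + ‖w - p‖ ^ 2 := by
  have key : ∀ t ∈ Set.Ioo (0 : ℝ) 1, (1 - t) * ((1 / (2 * h) - μ) * ‖w - y‖ ^ 2) ≤
      (F w + ‖w - p‖ ^ 2 / (2 * h)) - (F y + ‖y - p‖ ^ 2 / (2 * h)) := by
    rintro t ⟨ht0, ht1⟩
    have hz : t • w + (1 - t) • y ∈ C := hF.1 hw hy ht0.le (by linarith) (by ring)
    have h1 := hF.2 hw hy ht0.le (by linarith : 0 ≤ 1 - t) (by ring)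
    have h2 := hmin _ hz
    have h3 := norm_sq_convex_combination w y (by ring : t + (1 - t) = 1)
    have h4 := norm_sq_convex_combination (w - p) (y - p) (by ring : t + (1 - t) = 1)
    have h5 : t • (w - p) + (1 - t) • (y - p) = t • w + (1 - t) • y - p := by module
    rw [h5, sub_sub_sub_cancel_right] at h4
    simp only [smul_eq_mul] at h1
    rw [h3] at h1
    rw [h4] at h2
    refine le_of_mul_le_mul_left ?_ ht0
    simp only [div_eq_mul_inv] at *
    linarith
  have hlim : Filter.Tendsto (fun t : ℝ => (1 - t) * ((1 / (2 * h) - μ) * ‖w - y‖ ^ 2))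
      (nhdsWithin 0 (Set.Ioi 0)) (nhds ((1 - 0) * ((1 / (2 * h) - μ) * ‖w - y‖ ^ 2))) :=
    ((by fun_prop : Continuous fun t : ℝ =>
      (1 - t) * ((1 / (2 * h) - μ) * ‖w - y‖ ^ 2)).tendsto 0).mono_left nhdsWithin_le_nhds
  have := le_of_tendsto hlim (Filter.mem_of_superset (Ioo_mem_nhdsGT one_pos) key)
  field_simp at this
  linarith

/-- Existence of proximal points, with quadratic growth. -/
lemma exists_prox [ProperSpace E] {C : Set E} {F : E → ℝ} {μ h c : ℝ} (hC : IsClosed C)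
    (hh : 0 < h) (hF : ConvexOn ℝ C (fun x => F x + μ * ‖x‖ ^ 2)) (hFc : ContinuousOn F C)
    (hc : ∀ x ∈ C, c ≤ F x) {p : E} (hp : p ∈ C) :
    ∃ y ∈ C, ∀ w ∈ C,
      ‖y - p‖ ^ 2 + (1 - 2 * μ * h) * ‖w - y‖ ^ 2 ≤ 2 * h * (F w - F y) + ‖w - p‖ ^ 2 := by
  have hcont : ContinuousOn (fun w => F w + ‖w - p‖ ^ 2 / (2 * h)) C :=
    hFc.add (by fun_prop)
  obtain ⟨y, hy, hmin⟩ := hcont.exists_isMinOn' hC hp (by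
    have hev : ∀ᶠ x in Filter.cocompact E, 2 * h * (F p - c) + 1 ≤ ‖x - p‖ := by
      have := (tendsto_dist_right_cocompact_atTop p).eventually_ge_atTop (2 * h * (F p - c) + 1)
      simpa only [dist_eq_norm] using this
    filter_upwards [hev.filter_mono inf_le_left,
      (Filter.eventually_mem_set.2 (Filter.mem_principal_self C)).filter_mono inf_le_right]
      with x hx hxC
    have h0 : 0 ≤ 2 * h * (F p - c) := by
      have := hc p hp
      have : 0 ≤ F p - c := by linarith
      positivity
    have h1 : F p - c ≤ ‖x - p‖ ^ 2 / (2 * h) := by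
      rw [le_div_iff₀ (by positivity)]
      nlinarith
    have := hc x hxC
    simp only [sub_self, norm_zero]
    norm_num
    linarith)
  exact ⟨y, hy, fun w hw => prox_quadratic_growth hh hF hy hmin hw⟩

/-- Subgradient separation for the sum of a continuous convex function and a convex function. -/
lemma exists_subgradient_of_isMin_add [CompleteSpace E] {C : Set E} {φ K : E → ℝ} {y : E}
    (hφ : ConvexOn ℝ Set.univ φ) (hφc : Continuous φ) (hK : ConvexOn ℝ C K) (hy : y ∈ C)
    (hmin : ∀ w ∈ C, φ y + K y ≤ φ w + K w) :
    ∃ v : E, (∀ w, φ y + ⟪v, w - y⟫ ≤ φ w) ∧ ∀ w ∈ C, K y - ⟪v, w - y⟫ ≤ K w := by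
  have hA : Convex ℝ {q : E × ℝ | φ q.1 < q.2} := by
    simpa using hφ.convex_strict_epigraph
  have hAo : IsOpen {q : E × ℝ | φ q.1 < q.2} :=
    isOpen_lt (hφc.comp continuous_fst) continuous_snd
  have hB : Convex ℝ {q : E × ℝ | q.1 ∈ C ∧ q.2 ≤ φ y + K y - K q.1} := by
    have := ((concaveOn_const (φ y + K y) hK.1).sub hK).convex_hypograph
    exact this
  have hdisj : Disjoint {q : E × ℝ | φ q.1 < q.2}
      {q : E × ℝ | q.1 ∈ C ∧ q.2 ≤ φ y + K y - K q.1} := by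
    rw [Set.disjoint_left]
    rintro ⟨w, r⟩ h1 ⟨h2, h3⟩
    have := hmin w h2
    simp only [Set.mem_ofPred_eq] at h1 h3
    linarith
  obtain ⟨ℓ, s, hℓA, hℓB⟩ := geometric_hahn_banach_open hA hAo hB hdisj
  have hdec : ∀ w r, ℓ (w, r) = ℓ (w, 0) + r * ℓ (0, 1) := by
    intro w r
    have : ((w, r) : E × ℝ) = (w, 0) + r • (0, 1) := by simp
    rw [this, map_add, map_smul, smul_eq_mul]
  set b := ℓ (0, 1)
  have hyB : s ≤ ℓ (y, 0) + φ y * b := by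
    rw [← hdec]
    exact hℓB _ ⟨hy, by simp⟩
  have hle : ∀ w, ℓ (w, 0) + φ w * b ≤ s := by
    intro w
    have hev : ∀ t ∈ Set.Ioi (0 : ℝ), ℓ (w, 0) + (φ w + t) * b ≤ s := fun t ht => by
      rw [← hdec]
      exact (hℓA (w, φ w + t) (by simpa using ht)).le
    have hlim : Filter.Tendsto (fun t : ℝ => ℓ (w, 0) + (φ w + t) * b)
        (nhdsWithin 0 (Set.Ioi 0)) (nhds (ℓ (w, 0) + (φ w + 0) * b)) :=
      ((by fun_prop : Continuous fun t : ℝ => ℓ (w, 0) + (φ w + t) * b).tendsto 0).mono_left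
        nhdsWithin_le_nhds
    have := le_of_tendsto hlim (Filter.mem_of_superset self_mem_nhdsWithin hev)
    simpa using this
  have hb : b < 0 := by
    have h1 := hℓA (y, φ y + 1) (by simp)
    rw [hdec] at h1
    linarith
  let ℓ' : E →L[ℝ] ℝ := (-b)⁻¹ • ℓ.comp (ContinuousLinearMap.inl ℝ E ℝ)
  have hv : ∀ w, (-b) * ⟪(InnerProductSpace.toDual ℝ E).symm ℓ', w - y⟫ =
      ℓ (w, 0) - ℓ (y, 0) := by
    intro w
    rw [InnerProductSpace.toDual_symm_apply]
    have : ℓ' (w - y) = (-b)⁻¹ * (ℓ (w, 0) - ℓ (y, 0)) := by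
      simp only [ℓ', ← map_sub]
      simp
    rw [this, mul_inv_cancel_left₀ (by linarith)]
  refine ⟨(InnerProductSpace.toDual ℝ E).symm ℓ', fun w => ?_, fun w hw => ?_⟩
  · have h1 := hv w
    have h2 := hle w
    have : 0 ≤ (-b) * (φ w - (φ y + ⟪(InnerProductSpace.toDual ℝ E).symm ℓ', w - y⟫)) := by
      linarith
    have := nonneg_of_mul_nonneg_right this (by linarith)
    linarith
  · have h1 := hv w
    have h2 := hℓB (w, φ y + K y - K w) ⟨hw, le_rfl⟩
    rw [hdec] at h2
    have h3 := hle y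
    have : 0 ≤ (-b) * (K w - (K y - ⟪(InnerProductSpace.toDual ℝ E).symm ℓ', w - y⟫)) := by
      linarith
    have := nonneg_of_mul_nonneg_right this (by linarith)
    linarith

/-- Subdifferential sum rule for finitely many continuous convex functions and a convex one. -/
lemma exists_subgradients_of_sum [CompleteSpace E] {ι : Type*} {C : Set E} {φ : ι → E → ℝ}
    {G : E → ℝ} {y : E} (hφ : ∀ i, ConvexOn ℝ Set.univ (φ i)) (hφc : ∀ i, Continuous (φ i))
    (hG : ConvexOn ℝ C G) (hy : y ∈ C) (S : Finset ι) :
    ∀ u : E, (∀ w ∈ C, ∑ i ∈ S, φ i y + G y + ⟪u, w - y⟫ ≤ ∑ i ∈ S, φ i w + G w) →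
      ∃ v : ι → E, (∀ i ∈ S, ∀ w, φ i y + ⟪v i, w - y⟫ ≤ φ i w) ∧
        ∀ w ∈ C, G y + ⟪u - ∑ i ∈ S, v i, w - y⟫ ≤ G w := by
  classical
  induction S using Finset.induction_on with
  | empty => exact fun u hu => ⟨0, by simp, by simpa using hu⟩
  | insert a S ha ih =>
    intro u hu
    simp only [Finset.sum_insert ha] at hu
    have hK : ConvexOn ℝ C (fun w => ∑ i ∈ S, φ i w + G w - ⟪u, w⟫) := by
      have hsum := convexOn_finset_sum hG.1 S fun i _ => (hφ i).subset (Set.subset_univ C) hG.1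
      exact (hsum.add hG).sub ((innerSL ℝ u).toLinearMap.concaveOn hG.1)
    obtain ⟨va, hva, hva'⟩ := exists_subgradient_of_isMin_add (hφ a) (hφc a) hK hy
      (fun w hw => by
        have := hu w hw
        rw [inner_sub_right] at this
        linarith)
    obtain ⟨v, hv, hv'⟩ := ih (u - va) (fun w hw => by
      have := hva' w hw
      rw [inner_sub_left, inner_sub_right u]
      linarith)
    refine ⟨Function.update v a va, fun i hi w => ?_, fun w hw => ?_⟩
    · rcases eq_or_ne i a with rfl | hia
      · simpa using hva w
      · simpa [Function.update_of_ne hia] using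
          hv i ((Finset.mem_insert.1 hi).resolve_left hia) w
    · rw [Finset.sum_insert ha, Function.update_self, Finset.sum_congr rfl
        (fun i hi => Function.update_of_ne (ne_of_mem_of_not_mem hi ha) va v), ← sub_sub]
      exact hv' w hw

lemma exists_isProxSeq [ProperSpace E] {C : Set E} {F : E → ℝ} {μ h c : ℝ} (hC : IsClosed C)
    (hh : 0 < h) (hF : ConvexOn ℝ C (fun x => F x + μ * ‖x‖ ^ 2)) (hFc : ContinuousOn F C)
    (hc : ∀ x ∈ C, c ≤ F x) {x₀ : E} (hx₀ : x₀ ∈ C) :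
    ∃ y : ℕ → E, y 0 = x₀ ∧ IsProxSeq C F μ h y := by
  choose P hPC hP using fun p : C => exists_prox hC hh hF hFc hc p.2
  let y : ℕ → C := fun n => Nat.rec ⟨x₀, hx₀⟩ (fun _ p => ⟨P p, hPC p⟩) n
  refine ⟨fun n => (y n).1, rfl, fun i => ?_⟩
  exact ⟨(y i).2, hP (y i)⟩

/-- Existence of a curve satisfying the evolution variational inequality of `F` on `C`. -/
lemma exists_evi_curve [ProperSpace E] {C : Set E} {F : E → ℝ} {μ c : ℝ} (hC : IsClosed C)
    (hμ : 0 ≤ μ) (hF : ConvexOn ℝ C (fun x => F x + μ * ‖x‖ ^ 2)) (hFc : ContinuousOn F C)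
    (hc : ∀ x ∈ C, c ≤ F x) {x₀ : E} (hx₀ : x₀ ∈ C) :
    ∃ X : ℝ → E, X 0 = x₀ ∧ IsEVICurve C F μ X := by
  let b : ℕ → ℝ := fun n => (n : ℝ) + (2 * μ + 1)
  have hb : ∀ n, 0 < b n := fun n => by positivity
  have hq : ∀ n, 0 ≤ 1 - 2 * μ * (b n)⁻¹ := fun n => by
    have : 2 * μ * (b n)⁻¹ ≤ 1 := by
      rw [mul_inv_le_iff₀ (hb n)]
      simp only [b]
      have : (0 : ℝ) ≤ n := n.cast_nonneg
      linarith
    linarith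
  choose Y hY0 hY using fun n => exists_isProxSeq hC (inv_pos.2 (hb n)) hF hFc hc hx₀
  have hbt : Filter.Tendsto b Filter.atTop Filter.atTop :=
    Filter.tendsto_atTop_add_const_right _ _ tendsto_natCast_atTop_atTop
  let U : Ultrafilter ℕ := Filter.hyperfilter ℕ
  have hU : (U : Filter ℕ) ≤ Filter.atTop := Nat.hyperfilter_le_atTop
  have hfl : ∀ t, 0 ≤ t → Filter.Tendsto (fun n => (b n)⁻¹ * (⌊t * b n⌋₊ : ℝ)) U (nhds t) :=
    fun t ht => by
      have := ((tendsto_nat_floor_mul_div_atTop ht).comp hbt).mono_left hU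
      refine this.congr fun n => ?_
      simp only [Function.comp_apply]
      field_simp
  have hlim : ∀ t : ℝ, ∃ x, 0 ≤ t → x ∈ C ∧
      Filter.Tendsto (fun n => Y n ⌊t * b n⌋₊) U (nhds x) := by
    intro t
    by_cases ht : 0 ≤ t
    swap
    · exact ⟨0, fun h => absurd h ht⟩
    have hK : IsCompact (C ∩ Metric.closedBall x₀ (Real.sqrt (2 * t * (F x₀ - c)))) :=
      (isCompact_closedBall _ _).inter_left hC
    have hmem : ∀ n, Y n ⌊t * b n⌋₊ ∈
        C ∩ Metric.closedBall x₀ (Real.sqrt (2 * t * (F x₀ - c))) := fun n => by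
      refine ⟨(hY n _).1, ?_⟩
      rw [Metric.mem_closedBall, dist_eq_norm]
      refine Real.le_sqrt_of_sq_le ?_
      have h1 := (hY n).dist_sq_le (hq n) ⌊t * b n⌋₊
      rw [hY0] at h1
      have h2 : (b n)⁻¹ * (⌊t * b n⌋₊ : ℝ) ≤ t := by
        rw [inv_mul_le_iff₀ (hb n), mul_comm]
        exact Nat.floor_le (by have := (hb n).le; positivity)
      have h3 := hc _ (hY n ⌊t * b n⌋₊).1
      have h4 := hc _ hx₀
      have h5 := (hb n).le
      calc _ ≤ _ := h1
        _ ≤ 2 * ((b n)⁻¹ * (⌊t * b n⌋₊ : ℝ)) * (F x₀ - c) := by gcongr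
        _ ≤ _ := by
          have : 0 ≤ F x₀ - c := by linarith
          gcongr
    obtain ⟨x, hx, hxU⟩ := hK.ultrafilter_le_nhds (U.map fun n => Y n ⌊t * b n⌋₊) (by
      rw [Filter.le_principal_iff]
      exact Filter.mem_map.2 (Filter.univ_mem' hmem))
    exact ⟨x, fun _ => ⟨hx.1, hxU⟩⟩
  choose X hX using hlim
  have hXF : ∀ t, 0 ≤ t → Filter.Tendsto (fun n => F (Y n ⌊t * b n⌋₊)) U (nhds (F (X t))) :=
    fun t ht => (hFc _ (hX t ht).1).tendsto.comp
      (tendsto_nhdsWithin_iff.2 ⟨(hX t ht).2, .of_forall fun n => (hY n _).1⟩)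
  have hsub : ∀ s t, 0 ≤ s → s ≤ t → ∀ n, ∃ m : ℕ, ⌊t * b n⌋₊ = ⌊s * b n⌋₊ + m ∧
      (b n)⁻¹ * (m : ℝ) = (b n)⁻¹ * (⌊t * b n⌋₊ : ℝ) - (b n)⁻¹ * (⌊s * b n⌋₊ : ℝ) := by
    intro s t hs hst n
    have : ⌊s * b n⌋₊ ≤ ⌊t * b n⌋₊ := Nat.floor_mono (by have := (hb n).le; gcongr)
    refine ⟨⌊t * b n⌋₊ - ⌊s * b n⌋₊, by omega, ?_⟩
    rw [Nat.cast_sub this]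
    ring
  have hτ : ∀ s t, 0 ≤ s → s ≤ t → Filter.Tendsto (fun n => (b n)⁻¹ * (⌊t * b n⌋₊ : ℝ) -
      (b n)⁻¹ * (⌊s * b n⌋₊ : ℝ)) U (nhds (t - s)) :=
    fun s t hs hst => (hfl t (hs.trans hst)).sub (hfl s hs)
  refine ⟨X, ?_, fun t ht => (hX t ht).1, fun s t hs hst => ?_, fun s t hs hst => ?_,
    fun s t hs hst w hw => ?_⟩
  · refine tendsto_nhds_unique (hX 0 le_rfl).2 ?_
    simp [hY0]
  · refine le_of_tendsto_of_tendsto' (((hX t (hs.trans hst)).2.sub (hX s hs).2).norm.pow 2)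
      (((hτ s t hs hst).const_mul 2).mul ((hXF s hs).sub (hXF t (hs.trans hst)))) fun n => ?_
    obtain ⟨m, hm, hm'⟩ := hsub s t hs hst n
    rw [← hm', hm]
    exact ((hY n).shift _).dist_sq_le (hq n) m
  · refine le_of_tendsto_of_tendsto' (hXF t (hs.trans hst)) (hXF s hs) fun n => ?_
    obtain ⟨m, hm, -⟩ := hsub s t hs hst n
    exact (hY n).antitone (inv_pos.2 (hb n)) (hq n) (by omega)
  · have hd := (hXF t (hs.trans hst)).const_sub (F w)
    refine le_of_tendsto_of_tendsto'
      ((((hτ s t hs hst).const_mul (2 * μ)).const_sub 1).mul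
        (((hX t (hs.trans hst)).2.const_sub w).norm.pow 2))
      (((((hX s hs).2.const_sub w).norm.pow 2).add (((hτ s t hs hst).const_mul 2).mul hd)).add
        ((((hτ s t hs hst).pow 2).const_mul (4 * μ)).mul hd.abs)) fun n => ?_
    obtain ⟨m, hm, hm'⟩ := hsub s t hs hst n
    rw [← hm', hm]
    exact ((hY n).shift _).evi (inv_pos.2 (hb n)) hμ (hq n) m hw

end HilbertLemmas

namespace IsEVICurve

variable {E : Type*} [NormedAddCommGroup E] [InnerProductSpace ℝ E] {C : Set E} {F : E → ℝ}
  {μ c : ℝ} {X : ℝ → E}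

/-- Bound on the proximal displacement at `X T` by the decrease of `F` along the curve. -/
lemma prox_displacement_le (hX : IsEVICurve C F μ X) (hμ : 0 ≤ μ) (hc : ∀ x ∈ C, c ≤ F x)
    {T τ h κ : ℝ} (hT : 0 ≤ T) (hτ : 0 < τ) (hμτ : 2 * μ * τ ≤ 1) (hh : 0 < h)
    (hμh : 4 * μ * h ≤ 1) (hκ : F (X T) - F (X (T + τ)) ≤ κ) {y : E} (hy : y ∈ C)
    (hprox : ∀ w ∈ C, ‖y - X T‖ ^ 2 + (1 - 2 * μ * h) * ‖w - y‖ ^ 2 ≤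
      2 * h * (F w - F y) + ‖w - X T‖ ^ 2) :
    ‖y - X T‖ ^ 2 ≤ 8 * h ^ 2 * κ / τ + 4 * h * κ + 8 * h * μ * τ * (F (X 0) - c) := by
  set p := X T
  set r := ‖y - p‖
  set e := ‖X (T + τ) - p‖
  have hTτ : T ≤ T + τ := by linarith
  have hpC : p ∈ C := hX.mem T hT
  have h1 := hprox p hpC
  rw [norm_sub_rev p y, sub_self, norm_zero] at h1
  have he := hX.dist_sq_le T (T + τ) hT hTτ
  have hevi := hX.evi T (T + τ) hT hTτ y hy
  rw [add_sub_cancel_left] at he hevi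
  have hq : 0 ≤ 1 - 2 * μ * h := by nlinarith
  have hyp : F y ≤ F p := by
    have : 0 ≤ 2 * h * (F p - F y) := by
      have : 0 ≤ (1 - 2 * μ * h) * r ^ 2 := by positivity
      nlinarith [sq_nonneg r]
    have := nonneg_of_mul_nonneg_right this (by positivity)
    linarith
  have hp0 : F p ≤ F (X 0) := hX.le 0 T le_rfl hT
  have hX0 : F (X (T + τ)) ≤ F (X 0) := hX.le 0 (T + τ) le_rfl (by linarith)
  have hyc := hc y hy
  have hXc := hc _ (hX.mem (T + τ) (by linarith))
  have habs : |F y - F (X (T + τ))| ≤ F (X 0) - c := by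
    rw [abs_le]; constructor <;> linarith
  have hnorm : r ^ 2 - 2 * (r * e) ≤ ‖y - X (T + τ)‖ ^ 2 := by
    have h2 : y - X (T + τ) = (y - p) - (X (T + τ) - p) := by abel
    have h3 := real_inner_le_norm (y - p) (X (T + τ) - p)
    have h4 := norm_sub_sq_real (y - p) (X (T + τ) - p)
    rw [← h2] at h4
    have h5 : 0 ≤ ‖X (T + τ) - p‖ ^ 2 := by positivity
    linarith
  have hre : 0 ≤ r * e := by positivity
  have hκe : e ^ 2 ≤ 2 * τ * κ := he.trans (by gcongr)
  have h5 : (1 - 2 * μ * τ) * (r ^ 2 - 2 * (r * e)) ≤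
      r ^ 2 + 2 * τ * (F y - F p + κ) + 4 * μ * τ ^ 2 * (F (X 0) - c) := by
    calc _ ≤ (1 - 2 * μ * τ) * ‖y - X (T + τ)‖ ^ 2 := by
          have : 0 ≤ 1 - 2 * μ * τ := by linarith
          gcongr
      _ ≤ _ := hevi
      _ ≤ _ := by
          have : F y - F (X (T + τ)) ≤ F y - F p + κ := by linarith
          gcongr
  have h6 : 2 * τ * (F p - F y) ≤
      2 * μ * τ * r ^ 2 + 2 * (r * e) + 2 * τ * κ + 4 * μ * τ ^ 2 * (F (X 0) - c) := by
    have : 0 ≤ 2 * μ * τ * (2 * (r * e)) := by positivity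
    nlinarith
  have h7 : (2 - 2 * μ * h) * r ^ 2 * τ ≤ h * (2 * μ * τ * r ^ 2 + 2 * (r * e) + 2 * τ * κ +
      4 * μ * τ ^ 2 * (F (X 0) - c)) := by
    have := mul_le_mul_of_nonneg_left h6 hh.le
    have := mul_le_mul_of_nonneg_right h1 hτ.le
    linarith
  have h8 : r ^ 2 * τ ≤ h * (2 * (r * e) + 2 * τ * κ + 4 * μ * τ ^ 2 * (F (X 0) - c)) := by
    have : 4 * μ * h * (r ^ 2 * τ) ≤ 1 * (r ^ 2 * τ) := by gcongr
    linarith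
  have h9 : 2 * h * (r * e) * τ ≤ τ ^ 2 * r ^ 2 / 2 + 2 * h ^ 2 * e ^ 2 := by
    nlinarith [sq_nonneg (τ * r - 2 * h * e)]
  have h10 : 2 * h ^ 2 * e ^ 2 ≤ 2 * h ^ 2 * (2 * τ * κ) := by gcongr
  have h11 : τ ^ 2 * r ^ 2 ≤ τ ^ 2 *
      (8 * h ^ 2 * κ / τ + 4 * h * κ + 8 * h * μ * τ * (F (X 0) - c)) := by
    have h12 := mul_le_mul_of_nonneg_right h8 hτ.le
    have h13 : τ ^ 2 * (8 * h ^ 2 * κ / τ + 4 * h * κ + 8 * h * μ * τ * (F (X 0) - c)) =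
        8 * h ^ 2 * κ * τ + τ ^ 2 * (4 * h * κ + 8 * h * μ * τ * (F (X 0) - c)) := by
      field_simp
      ring
    rw [h13]
    linarith
  exact le_of_mul_le_mul_left h11 (by positivity)

/-- Eventually along the curve, proximal steps of a fixed size are arbitrarily short. -/
lemma exists_forall_prox_displacement_le (hX : IsEVICurve C F μ X) (hμ : 0 ≤ μ)
    (hc : ∀ x ∈ C, c ≤ F x) {h r : ℝ} (hh : 0 < h) (hμh : 4 * μ * h ≤ 1) (hr : 0 < r) :
    ∃ T₀ ≥ (0 : ℝ), ∀ T ≥ T₀, ∀ y ∈ C,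
      (∀ w ∈ C, ‖y - X T‖ ^ 2 + (1 - 2 * μ * h) * ‖w - y‖ ^ 2 ≤
        2 * h * (F w - F y) + ‖w - X T‖ ^ 2) → ‖y - X T‖ ≤ r := by
  have hM : 0 ≤ F (X 0) - c := by have := hc _ (hX.mem 0 le_rfl); linarith
  obtain ⟨τ, hτ, hτ1, hτ2⟩ : ∃ τ > 0, 2 * μ * τ ≤ 1 ∧
      8 * h * μ * τ * (F (X 0) - c) ≤ r ^ 2 / 2 := by
    have h1 : 0 < 2 * μ + 1 := by positivity
    have h2 : 0 < 16 * h * μ * (F (X 0) - c) + 1 := by positivity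
    refine ⟨min (1 / (2 * μ + 1)) (r ^ 2 / (16 * h * μ * (F (X 0) - c) + 1)),
      by positivity, ?_, ?_⟩
    · have h3 := (le_div_iff₀ h1).1 (min_le_left (1 / (2 * μ + 1))
        (r ^ 2 / (16 * h * μ * (F (X 0) - c) + 1)))
      have : 0 < min (1 / (2 * μ + 1)) (r ^ 2 / (16 * h * μ * (F (X 0) - c) + 1)) := by positivity
      linarith
    · have h3 := (le_div_iff₀ h2).1 (min_le_right (1 / (2 * μ + 1))
        (r ^ 2 / (16 * h * μ * (F (X 0) - c) + 1)))
      have : 0 < min (1 / (2 * μ + 1)) (r ^ 2 / (16 * h * μ * (F (X 0) - c) + 1)) := by positivity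
      linarith
  obtain ⟨κ, hκ, hκ1⟩ : ∃ κ > 0, 8 * h ^ 2 * κ / τ + 4 * h * κ ≤ r ^ 2 / 2 := by
    refine ⟨r ^ 2 / 2 / (8 * h ^ 2 / τ + 4 * h), by positivity, le_of_eq ?_⟩
    field_simp
  have hbdd : BddBelow ((fun t => F (X t)) '' Set.Ici 0) :=
    ⟨c, by rintro _ ⟨t, ht, rfl⟩; exact hc _ (hX.mem t ht)⟩
  obtain ⟨_, ⟨T₀, hT₀, rfl⟩, hlt⟩ := exists_lt_of_csInf_lt
    (Set.Nonempty.image (fun t => F (X t)) ⟨(0 : ℝ), Set.self_mem_Ici⟩)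
    (lt_add_of_pos_right (sInf ((fun t => F (X t)) '' Set.Ici 0)) hκ)
  refine ⟨T₀, hT₀, fun T hT y hy hprox => ?_⟩
  have hT0 : 0 ≤ T := le_trans hT₀ hT
  have h1 := csInf_le hbdd ⟨T + τ, show (0 : ℝ) ≤ T + τ by linarith, rfl⟩
  have h2 := hX.le T₀ T hT₀ hT
  have h3 := hX.prox_displacement_le hμ hc hT0 hτ hτ1 hh hμh (κ := κ)
    (by simp only at hlt h1; linarith) hy hprox
  exact le_of_sq_le_sq (by linarith) hr.le

end IsEVICurve

section ExtendedReal

variable {d : ℕ} {g : Euc d → EReal}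

lemma ProperFn.coe_toReal (hg : ProperFn g) {x : Euc d} (hx : g x ≠ ⊤) :
    ((g x).toReal : EReal) = g x :=
  EReal.coe_toReal hx (hg.2 x)

lemma ConvexFn.convexOn_toReal (hg : ProperFn g) (hc : ConvexFn g) :
    ConvexOn ℝ {x | g x ≠ ⊤} (fun x => (g x).toReal) := by
  have key : ∀ x, g x ≠ ⊤ → ∀ y, g y ≠ ⊤ → ∀ a b : ℝ, 0 ≤ a → 0 ≤ b → a + b = 1 →
      g (a • x + b • y) ≤ ((a * (g x).toReal + b * (g y).toReal : ℝ) : EReal) := by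
    intro x hx y hy a b ha hb hab
    have := hc (x := (x, (g x).toReal)) (hg.coe_toReal hx).ge (y := (y, (g y).toReal))
      (hg.coe_toReal hy).ge ha hb hab
    simpa using this
  refine ⟨fun x hx y hy a b ha hb hab => ?_, fun x hx y hy a b ha hb hab => ?_⟩
  · exact ((key x hx y hy a b ha hb hab).trans_lt (EReal.coe_lt_top _)).ne
  · have h1 := key x hx y hy a b ha hb hab
    rw [← hg.coe_toReal (h1.trans_lt (EReal.coe_lt_top _)).ne] at h1
    exact_mod_cast h1

lemma mem_subdiff_of_toReal (hg : ProperFn g) {x s : Euc d} (hx : g x ≠ ⊤)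
    (h : ∀ y, g y ≠ ⊤ → (g x).toReal + ⟪s, y - x⟫ ≤ (g y).toReal) : s ∈ Subdiff g x := by
  intro y
  by_cases hy : g y = ⊤
  · simp [hy]
  · rw [← hg.coe_toReal hx, ← hg.coe_toReal hy]
    exact_mod_cast h y hy

lemma toReal_add_le_of_forall_le (hg : ProperFn g) {x : Euc d} {q : Euc d → ℝ}
    (h : ∀ w, g x + (q x : EReal) ≤ g w + (q w : EReal)) :
    g x ≠ ⊤ ∧ ∀ w, g w ≠ ⊤ → (g x).toReal + q x ≤ (g w).toReal + q w := by
  have hx : g x ≠ ⊤ := by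
    obtain ⟨w, hw⟩ := hg.1
    have h1 := h w
    rw [← hg.coe_toReal hw] at h1
    intro hx
    rw [hx, EReal.top_add_coe, ← EReal.coe_add, top_le_iff] at h1
    exact EReal.coe_ne_top _ h1
  refine ⟨hx, fun w hw => ?_⟩
  have h1 := h w
  rw [← hg.coe_toReal hx, ← hg.coe_toReal hw] at h1
  exact_mod_cast h1

lemma LocLipOnDom.continuousOn_toReal (hl : LocLipOnDom g) :
    ContinuousOn (fun x => (g x).toReal) {x | g x ≠ ⊤} := by
  intro x hx
  obtain ⟨ε, hε, K, hK⟩ := hl x hx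
  rw [ContinuousWithinAt, tendsto_iff_norm_sub_tendsto_zero]
  have hlim : Filter.Tendsto (fun y => K * ‖y - x‖) (nhdsWithin x {x | g x ≠ ⊤}) (nhds 0) := by
    have : Filter.Tendsto (fun y => K * ‖y - x‖) (nhds x) (nhds (K * ‖x - x‖)) :=
      (by fun_prop : Continuous fun y => K * ‖y - x‖).tendsto x
    simpa using this.mono_left nhdsWithin_le_nhds
  refine squeeze_zero' (.of_forall fun y => norm_nonneg _) ?_ hlim
  filter_upwards [self_mem_nhdsWithin,
    mem_nhdsWithin_of_mem_nhds (Metric.closedBall_mem_nhds x hε)] with y hy hyε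
  rw [Metric.mem_closedBall, dist_eq_norm] at hyε
  exact hK y hy x hx hyε (by simpa using hε.le)

/-- A convex function that is locally Lipschitz on its domain decreases at most linearly from
points of a bounded set. -/
lemma exists_forall_sub_le_mul_norm (hg : ProperFn g) (hc : ConvexFn g) (hl : LocLipOnDom g)
    (hcl : IsClosed {x | g x ≠ ⊤}) (R : ℝ) :
    ∃ K ≥ (0 : ℝ), ∀ x, g x ≠ ⊤ → ‖x‖ ≤ R → ∀ u, g u ≠ ⊤ →
      (g x).toReal - (g u).toReal ≤ K * ‖x - u‖ := by
  have hconv := hc.convexOn_toReal hg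
  have hcomp : IsCompact ({x | g x ≠ ⊤} ∩ Metric.closedBall (0 : Euc d) R) :=
    (isCompact_closedBall _ _).inter_left hcl
  have : ∃ K ≥ (0 : ℝ), ∀ x ∈ {x | g x ≠ ⊤} ∩ Metric.closedBall (0 : Euc d) R, g x ≠ ⊤ →
      ∀ u, g u ≠ ⊤ → (g x).toReal - (g u).toReal ≤ K * ‖x - u‖ := by
    refine hcomp.induction_on (p := fun S => ∃ K ≥ (0 : ℝ), ∀ x ∈ S, g x ≠ ⊤ →
      ∀ u, g u ≠ ⊤ → (g x).toReal - (g u).toReal ≤ K * ‖x - u‖) ⟨0, le_rfl, by simp⟩ ?_ ?_ ?_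
    · rintro s t hst ⟨K, hK, h⟩
      exact ⟨K, hK, fun x hx => h x (hst hx)⟩
    · rintro s t ⟨K, hK, h⟩ ⟨K', hK', h'⟩
      refine ⟨max K K', hK.trans (le_max_left _ _), ?_⟩
      rintro x (hx | hx) hgx u hu
      · exact (h x hx hgx u hu).trans (by gcongr; exact le_max_left _ _)
      · exact (h' x hx hgx u hu).trans (by gcongr; exact le_max_right _ _)
    · rintro x ⟨hx, -⟩
      obtain ⟨ε, hε, K, hK⟩ := hl x hx
      refine ⟨Metric.closedBall x (ε / 2),
        mem_nhdsWithin_of_mem_nhds (Metric.closedBall_mem_nhds x (by positivity)),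
        max K 0, le_max_right _ _, fun y hyb hy u hu => ?_⟩
      rw [Metric.mem_closedBall, dist_eq_norm] at hyb
      have hK0 : ∀ z, g z ≠ ⊤ → ‖z - y‖ ≤ ε / 2 →
          (g y).toReal - (g z).toReal ≤ max K 0 * ‖y - z‖ := fun z hz hzy => by
        have h1 : ‖z - x‖ ≤ ε := by
          have := norm_add_le (z - y) (y - x)
          rw [sub_add_sub_cancel] at this
          linarith
        refine ((le_abs_self _).trans (hK y hy z hz (by linarith) h1)).trans ?_
        gcongr
        exact le_max_left _ _
      rcases le_total ‖u - y‖ (ε / 2) with hle | hle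
      · exact hK0 u hu hle
      have hpos : 0 < ‖u - y‖ := by linarith
      set t := ε / 2 / ‖u - y‖
      have ht0 : 0 < t := by positivity
      have ht1 : t ≤ 1 := (div_le_one hpos).2 hle
      have htu : t * ‖u - y‖ = ε / 2 := div_mul_cancel₀ _ hpos.ne'
      have hz : g (t • u + (1 - t) • y) ≠ ⊤ := hconv.1 hu hy ht0.le (by linarith) (by ring)
      have hzc := hconv.2 hu hy ht0.le (by linarith : 0 ≤ 1 - t) (by ring)
      have hzy : t • u + (1 - t) • y - y = t • (u - y) := by module
      have hzn : ‖t • u + (1 - t) • y - y‖ = t * ‖u - y‖ := by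
        rw [hzy, norm_smul, Real.norm_of_nonneg ht0.le]
      have h2 := hK0 _ hz (by rw [hzn, htu])
      rw [norm_sub_rev, hzn] at h2
      simp only [smul_eq_mul] at hzc
      rw [norm_sub_rev y u]
      refine le_of_mul_le_mul_left ?_ ht0
      linarith
  obtain ⟨K, hK, h⟩ := this
  exact ⟨K, hK, fun x hx hxR => h x ⟨hx, by simpa using hxR⟩ hx⟩

lemma LocBounded.exists_bound {D : Euc d → Set (Euc d)} (hD : LocBounded D) (R : ℝ) :
    ∃ B ≥ (0 : ℝ), ∀ x, ‖x‖ ≤ R → ∀ v ∈ D x, ‖v‖ ≤ B := by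
  have : ∃ B ≥ (0 : ℝ), ∀ x ∈ Metric.closedBall (0 : Euc d) R, ∀ v ∈ D x, ‖v‖ ≤ B := by
    refine (isCompact_closedBall (0 : Euc d) R).induction_on
      (p := fun S => ∃ B ≥ (0 : ℝ), ∀ x ∈ S, ∀ v ∈ D x, ‖v‖ ≤ B) ⟨0, le_rfl, by simp⟩ ?_ ?_ ?_
    · rintro s t hst ⟨B, hB, h⟩
      exact ⟨B, hB, fun x hx => h x (hst hx)⟩
    · rintro s t ⟨B, hB, h⟩ ⟨B', hB', h'⟩
      refine ⟨max B B', hB.trans (le_max_left _ _), ?_⟩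
      rintro x (hx | hx) v hv
      · exact (h x hx v hv).trans (le_max_left _ _)
      · exact (h' x hx v hv).trans (le_max_right _ _)
    · intro x _
      obtain ⟨ε, hε, hb⟩ := hD x
      obtain ⟨B, hB⟩ := hb.exists_norm_le
      refine ⟨Metric.ball x ε, mem_nhdsWithin_of_mem_nhds (Metric.ball_mem_nhds x hε),
        max B 0, le_max_right _ _, fun y hy v hv => ?_⟩
      exact (hB v (Set.mem_biUnion hy hv)).trans (le_max_left _ _)
  obtain ⟨B, hB, h⟩ := this
  exact ⟨B, hB, fun x hx => h x (by simpa using hx)⟩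

end ExtendedReal

namespace IsEVICurve

variable {E : Type*} [NormedAddCommGroup E] {C : Set E} {F : E → ℝ} {μ c : ℝ} {X : ℝ → E}

/-- One-step comparison of an evolution variational inequality curve with an approximate step. -/
lemma comparison_step (hX : IsEVICurve C F μ X) (hμ : 0 ≤ μ) {s α M B : ℝ} {x x' : E}
    (hs : 0 ≤ s) (hα : 0 < α) (hμα : 4 * μ * α ≤ 1) (hx : x ∈ C) (hxM : |F x| ≤ M)
    (hXM : |F (X (s + α))| ≤ M) (hdec : F x - F x' ≤ B * α)
    (hstep : ‖X (s + α) - x'‖ ^ 2 ≤ (1 + 2 * μ * α) * ‖X (s + α) - x‖ ^ 2 +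
      2 * α * (F (X (s + α)) - F x') + B * α ^ 2) :
    ‖X (s + α) - x'‖ ^ 2 ≤
      (1 + 8 * μ * α) * ‖X s - x‖ ^ 2 + (56 * μ * M + 3 * B) * α ^ 2 := by
  have h1 := hX.evi s (s + α) hs (by linarith) x hx
  rw [add_sub_cancel_left, norm_sub_rev x, norm_sub_rev x] at h1
  have hM : 0 ≤ M := (abs_nonneg _).trans hxM
  have habs : |F x - F (X (s + α))| ≤ 2 * M := (abs_sub _ _).trans (by linarith)
  have h2 : 4 * μ * α ^ 2 * |F x - F (X (s + α))| ≤ 4 * μ * α ^ 2 * (2 * M) := by gcongr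
  have h3 : 2 * α * (F x - F (X (s + α))) ≤ 2 * α * (2 * M) := by
    gcongr
    exact (le_abs_self _).trans habs
  have h4 : 2 * α * (F x - F x') ≤ 2 * α * (B * α) := by gcongr
  have h5 : 4 * μ * α * ‖X (s + α) - x‖ ^ 2 ≤ 1 * ‖X (s + α) - x‖ ^ 2 := by gcongr
  have h6 : 4 * μ * α * (α * M) ≤ 1 * (α * M) := by gcongr
  have h7 : ‖X (s + α) - x‖ ^ 2 ≤ 2 * ‖X s - x‖ ^ 2 + 12 * α * M := by linarith
  have h8 : 4 * μ * α * ‖X (s + α) - x‖ ^ 2 ≤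
      4 * μ * α * (2 * ‖X s - x‖ ^ 2 + 12 * α * M) := by gcongr
  linarith

/-- Small-step approximations of an evolution variational inequality curve with total step `T`
converge to a point near the value of the curve at time `T`. -/
lemma exists_tendsto_near [CompleteSpace E] (hX : IsEVICurve C F μ X) (hμ : 0 ≤ μ)
    (hc : ∀ x ∈ C, c ≤ F x) (hM : ∀ R : ℝ, ∃ M, ∀ x ∈ C, ‖x‖ ≤ R → |F x| ≤ M)
    {Step : ℝ → E → E → Prop}
    (hStep : ∀ R : ℝ, ∃ L ≥ (0 : ℝ), ∃ B ≥ (0 : ℝ), ∃ a > (0 : ℝ), ∀ α, 0 < α → α ≤ a →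
      ∀ x x', x ∈ C → ‖x‖ ≤ R → Step α x x' →
        x' ∈ C ∧ ‖x' - x‖ ≤ L * α ∧ F x - F x' ≤ B * α ∧
        ∀ w ∈ C, ‖w‖ ≤ R → ‖w - x'‖ ^ 2 ≤
          (1 + 2 * μ * α) * ‖w - x‖ ^ 2 + 2 * α * (F w - F x') + B * α ^ 2)
    (T : ℝ) {η : ℝ} (hη : 0 < η) :
    ∃ αbar > (0 : ℝ), ∀ (α : ℕ → ℝ) (xs : ℕ → E), (∀ k, Step (α k) (xs k) (xs (k + 1))) →
      xs 0 = X 0 → (∀ k, 0 < α k ∧ α k ≤ αbar) → HasSum α T →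
      ∃ xstar, Filter.Tendsto xs Filter.atTop (nhds xstar) ∧ ‖xstar - X T‖ ≤ η := by
  set R := ‖X 0‖ + Real.sqrt (2 * T * (F (X 0) - c)) + 1
  have hXR : ∀ t, 0 ≤ t → t ≤ T → ‖X t‖ ≤ R - 1 := fun t ht htT => by
    have h1 := hX.dist_sq_le 0 t le_rfl ht
    have h2 := hc _ (hX.mem t ht)
    have h3 := hX.le 0 t le_rfl ht
    have h4 : ‖X t - X 0‖ ≤ Real.sqrt (2 * T * (F (X 0) - c)) := by
      refine Real.le_sqrt_of_sq_le (h1.trans ?_)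
      have : 0 ≤ F (X 0) - F (X t) := by linarith
      have h2T : 0 ≤ 2 * T := by linarith
      rw [sub_zero]
      gcongr
    have h5 := norm_le_norm_add_norm_sub' (X t) (X 0)
    simp only [R]
    linarith
  obtain ⟨L, hL, B, hB, a, ha, hstep⟩ := hStep R
  obtain ⟨M, hM⟩ := hM R
  rcases lt_or_ge T 0 with hT | hT
  · refine ⟨1, one_pos, fun α xs _ _ hα hsum => absurd (hsum.nonneg fun k => (hα k).1.le) ?_⟩
    exact not_le.2 hT
  have hM0 : 0 ≤ M := (abs_nonneg _).trans (hM _ (hX.mem T hT) (by linarith [hXR T hT le_rfl]))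
  set B' := 56 * μ * M + 3 * B
  have hB' : 0 ≤ B' := by positivity
  set Q := Real.exp (8 * μ * T) * B' * T
  have hQ : 0 ≤ Q := by positivity
  obtain ⟨αbar, hαbar, hαa, hαμ, hα1, hαη⟩ : ∃ αbar > 0, αbar ≤ a ∧ 4 * μ * αbar ≤ 1 ∧
      Q * αbar ≤ 1 ∧ Q * αbar ≤ η ^ 2 := by
    refine ⟨min a (min (1 / (4 * μ + 1)) (min (1 / (Q + 1)) (η ^ 2 / (Q + 1)))), by positivity,
      min_le_left _ _, ?_⟩
    set m := min a (min (1 / (4 * μ + 1)) (min (1 / (Q + 1)) (η ^ 2 / (Q + 1))))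
    have hm : 0 < m := by positivity
    have h1 : m ≤ 1 / (4 * μ + 1) := (min_le_right _ _).trans (min_le_left _ _)
    have h2 : m ≤ 1 / (Q + 1) :=
      (min_le_right _ _).trans ((min_le_right _ _).trans (min_le_left _ _))
    have h3 : m ≤ η ^ 2 / (Q + 1) :=
      (min_le_right _ _).trans ((min_le_right _ _).trans (min_le_right _ _))
    rw [le_div_iff₀ (by positivity)] at h1 h2 h3
    refine ⟨?_, ?_, ?_⟩ <;> linarith
  refine ⟨αbar, hαbar, fun α xs hxs hxs0 hα hsum => ?_⟩
  let t : ℕ → ℝ := fun k => ∑ i ∈ Finset.range k, α i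
  have ht0 : ∀ k, 0 ≤ t k := fun k => Finset.sum_nonneg fun i _ => (hα i).1.le
  have htT : ∀ k, t k ≤ T := fun k => sum_le_hasSum _ (fun i _ => (hα i).1.le) hsum
  have htlim : Filter.Tendsto t Filter.atTop (nhds T) := hsum.tendsto_sum_nat
  have hts : ∀ k, t (k + 1) = t k + α k := fun k => Finset.sum_range_succ _ _
  have hclose : ∀ k, Real.exp (8 * μ * t k) * B' * t k * αbar ≤ Q * αbar := fun k => by
    have h1 := htT k
    have h2 := ht0 k
    simp only [Q]
    gcongr
  have hnear : ∀ k, ‖X (t k) - xs k‖ ^ 2 ≤ Q * αbar → ‖xs k‖ ≤ R := fun k hk => by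
    have h1 : ‖X (t k) - xs k‖ ≤ 1 := by
      rw [← abs_of_nonneg (norm_nonneg (X (t k) - xs k)), ← sq_le_one_iff_abs_le_one]
      exact hk.trans hα1
    have h2 := norm_le_norm_add_norm_sub (X (t k)) (xs k)
    linarith [hXR (t k) (ht0 k) (htT k)]
  have hinv : ∀ k, xs k ∈ C ∧
      ‖X (t k) - xs k‖ ^ 2 ≤ Real.exp (8 * μ * t k) * B' * t k * αbar := by
    intro k
    induction k with
    | zero => simp [t, hxs0, hX.mem 0 le_rfl]
    | succ k ih =>
      obtain ⟨hk, hd⟩ := ih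
      have hkR := hnear k (hd.trans (hclose k))
      obtain ⟨h1, -, h3, h4⟩ := hstep (α k) (hα k).1 ((hα k).2.trans hαa) _ _ hk hkR (hxs k)
      refine ⟨h1, ?_⟩
      have hXk := hX.mem (t (k + 1)) (ht0 _)
      have hXkR : ‖X (t (k + 1))‖ ≤ R := by linarith [hXR _ (ht0 (k + 1)) (htT (k + 1))]
      have hα0 := (hα k).1
      have hαk := (hα k).2
      have hμα : 4 * μ * α k ≤ 1 := le_trans (by gcongr) hαμ
      have hMX := hM _ hXk hXkR
      have h5 := h4 _ hXk hXkR
      rw [hts k] at hMX h5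
      have h6 := hX.comparison_step hμ (ht0 k) hα0 hμα hk (hM _ hk hkR) hMX h3 h5
      rw [hts k]
      have hexp : 1 + 8 * μ * α k ≤ Real.exp (8 * μ * α k) := by
        linarith [Real.add_one_le_exp (8 * μ * α k)]
      have htk := ht0 k
      have hone : 1 ≤ Real.exp (8 * μ * (t k + α k)) := Real.one_le_exp (by positivity)
      calc _ ≤ _ := h6
        _ ≤ Real.exp (8 * μ * α k) * (Real.exp (8 * μ * t k) * B' * t k * αbar) +
            1 * (B' * (α k * αbar)) := by
          rw [one_mul, pow_two (α k)]
          gcongr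
        _ ≤ Real.exp (8 * μ * α k) * (Real.exp (8 * μ * t k) * B' * t k * αbar) +
            Real.exp (8 * μ * (t k + α k)) * (B' * (α k * αbar)) := by gcongr
        _ = _ := by
          rw [mul_add (8 * μ), Real.exp_add]
          ring
  have hdist : ∀ k, dist (xs k) (xs (k + 1)) ≤ L * α k := fun k => by
    obtain ⟨hk, hd⟩ := hinv k
    rw [dist_eq_norm, norm_sub_rev]
    exact (hstep (α k) (hα k).1 ((hα k).2.trans hαa) _ _ hk (hnear k (hd.trans (hclose k)))
      (hxs k)).2.1
  obtain ⟨xstar, hxstar⟩ := cauchySeq_tendsto_of_complete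
    (cauchySeq_of_dist_le_of_summable _ hdist (hsum.summable.mul_left L))
  refine ⟨xstar, hxstar, ?_⟩
  have hXlim : Filter.Tendsto (fun k => X (t k)) Filter.atTop (nhds (X T)) := by
    rw [tendsto_iff_norm_sub_tendsto_zero]
    have h1 : Filter.Tendsto (fun k => Real.sqrt (2 * (T - t k) * (F (X 0) - c)))
        Filter.atTop (nhds (Real.sqrt (2 * (T - T) * (F (X 0) - c)))) :=
      (((htlim.const_sub T).const_mul 2).mul_const _).sqrt
    rw [sub_self, mul_zero, zero_mul, Real.sqrt_zero] at h1
    refine squeeze_zero (fun _ => norm_nonneg _) (fun k => ?_) h1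
    rw [norm_sub_rev]
    refine Real.le_sqrt_of_sq_le ((hX.dist_sq_le _ _ (ht0 k) (htT k)).trans ?_)
    have h2 := hc _ (hX.mem T hT)
    have h3 := hX.le 0 (t k) le_rfl (ht0 k)
    have h4 := htT k
    have : 0 ≤ T - t k := by linarith
    gcongr
  have hle := le_of_tendsto' ((hXlim.sub hxstar).norm.pow 2)
    fun k => (hinv k).2.trans ((hclose k).trans hαη)
  rw [norm_sub_rev]
  exact le_of_sq_le_sq hle hη.le

end IsEVICurve

section Reshuffling

variable {d N : ℕ} {f : Fin N → Euc d → ℝ} {D : Fin N → Euc d → Set (Euc d)} {g : Euc d → EReal}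
  {ρ : ℝ}

/-- One outer iteration of proximal random reshuffling. -/
def IsPRRStep {d : ℕ} (N : ℕ) (D : Fin N → Euc d → Set (Euc d)) (g : Euc d → EReal)
    (α : ℝ) (x x' : Euc d) : Prop :=
  ∃ (σ : Equiv.Perm (Fin N)) (z : ℕ → Euc d),
    z 0 = x ∧
    (∀ i : Fin N, ∃ v ∈ D (σ i) (z i.1), z (i.1 + 1) = z i.1 - α • v) ∧
    (∀ w : Euc d,
      g x' + ((‖x' - z N‖ ^ 2 / (2 * α) : ℝ) : EReal) ≤
        g w + ((‖w - z N‖ ^ 2 / (2 * α) : ℝ) : EReal))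

/-- The objective, with real values (meaningful on the domain of `g`). -/
def realPhi {d N : ℕ} (f : Fin N → Euc d → ℝ) (g : Euc d → EReal) (x : Euc d) : ℝ :=
  ∑ i, f i x + (g x).toReal

lemma convexOn_realPhi_add (hg : ProperFn g) (hc : ConvexFn g)
    (hwc : ∀ i, ConvexOn ℝ Set.univ (fun x : Euc d => f i x + ρ * ‖x‖ ^ 2)) :
    ConvexOn ℝ {x | g x ≠ ⊤} (fun x => realPhi f g x + N * ρ * ‖x‖ ^ 2) := by
  have hG := hc.convexOn_toReal hg
  have hsum := convexOn_finset_sum hG.1 Finset.univ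
    fun i _ => (hwc i).subset (Set.subset_univ _) hG.1
  refine (hsum.add hG).congr fun x _ => ?_
  simp only [Pi.add_apply, realPhi, Finset.sum_add_distrib, Finset.sum_const, Finset.card_univ,
    Fintype.card_fin, nsmul_eq_mul]
  ring

/-- The residual of a proximal step on `Φ` belongs to `D_Φ`. -/
lemma smul_sub_mem_DPhi (hg : ProperFn g) (hc : ConvexFn g) (hfc : ∀ i, Continuous (f i))
    (hwc : ∀ i, ConvexOn ℝ Set.univ (fun x : Euc d => f i x + ρ * ‖x‖ ^ 2))
    (hDdef : ∀ i x, D i x = WSubdiff (f i) ρ x) {h : ℝ} (hh : 0 < h) {p y : Euc d}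
    (hy : g y ≠ ⊤)
    (hprox : ∀ w, g w ≠ ⊤ → ‖y - p‖ ^ 2 + (1 - 2 * (N * ρ) * h) * ‖w - y‖ ^ 2 ≤
      2 * h * (realPhi f g w - realPhi f g y) + ‖w - p‖ ^ 2) :
    h⁻¹ • (p - y) ∈ DPhi N D g y := by
  have hφ : ∀ i, ConvexOn ℝ Set.univ (fun w => f i w + ρ * ‖w - y‖ ^ 2) := fun i => by
    have h1 := ((hwc i).add_const (ρ * ‖y‖ ^ 2)).add
      (((2 * ρ) • innerSL ℝ (-y)).toLinearMap.convexOn convex_univ)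
    refine h1.congr fun w _ => ?_
    simp [norm_sub_sq_real, real_inner_comm y w]
    ring
  obtain ⟨v, hv, hs⟩ := exists_subgradients_of_sum hφ
    (fun i => (hfc i).add (by fun_prop)) (hc.convexOn_toReal hg) hy Finset.univ
    (h⁻¹ • (p - y)) (fun w hw => by
      have h1 := hprox w hw
      have h2 := norm_add_sq_real (w - y) (y - p)
      rw [sub_add_sub_cancel] at h2
      have h3 : h * ⟪h⁻¹ • (p - y), w - y⟫ = - ⟪w - y, y - p⟫ := by
        rw [inner_smul_left, ← neg_sub y p, inner_neg_left, real_inner_comm]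
        simp [hh.ne']
      simp only [realPhi] at h1
      simp only [Finset.sum_add_distrib, Finset.sum_const, Finset.card_univ,
        Fintype.card_fin, nsmul_eq_mul, sub_self, norm_zero]
      refine le_of_mul_le_mul_left ?_ hh
      linarith)
  refine ⟨v, fun i => ?_, _, mem_subdiff_of_toReal hg hy hs, by abel⟩
  rw [hDdef]
  intro w
  have := hv i (Finset.mem_univ i) w
  simp only [sub_self, norm_zero] at this
  linarith

/-- A subgradient at `z` almost satisfies the subgradient inequality between `w` and `x'` when `z`
and `x'` are both close to `x`. -/
lemma inner_sub_le_of_mem_WSubdiff {φ : Euc d → ℝ} {B r W : ℝ} (hρ : 0 ≤ ρ)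
    {x x' z w u v : Euc d} (hv : v ∈ WSubdiff φ ρ z) (hu : u ∈ WSubdiff φ ρ x')
    (hvB : ‖v‖ ≤ B) (huB : ‖u‖ ≤ B) (hr : r ≤ 1) (hzx : ‖z - x‖ ≤ r) (hxx' : ‖x' - x‖ ≤ r)
    (hwx : ‖w - x‖ ≤ W) :
    ⟪v, w - x'⟫ ≤ φ w - φ x' + (ρ * ‖w - x‖ ^ 2 + r * (4 * B + 5 * ρ + 2 * ρ * W)) := by
  have hr0 : 0 ≤ r := (norm_nonneg _).trans hzx
  have hB : 0 ≤ B := (norm_nonneg _).trans hvB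
  have hW : 0 ≤ W := (norm_nonneg _).trans hwx
  have hrr : r ^ 2 ≤ r := by nlinarith
  have h1 := hv w
  have h2 := hu z
  have h3 : ‖z - x'‖ ≤ 2 * r := by
    have := norm_sub_le_norm_sub_add_norm_sub z x x'
    rw [norm_sub_rev x x'] at this
    linarith
  have h4 : ⟪v, z - x'⟫ ≤ B * (2 * r) := (real_inner_le_norm _ _).trans (by gcongr)
  have h5 : -(B * (2 * r)) ≤ ⟪u, z - x'⟫ :=
    neg_le_of_abs_le ((abs_real_inner_le_norm _ _).trans (by gcongr))
  have h6 : ‖z - x'‖ ^ 2 ≤ (2 * r) ^ 2 := by gcongr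
  have h7 : ‖w - z‖ ^ 2 ≤ ‖w - x‖ ^ 2 + (2 * W + 1) * r := by
    have h8 := norm_sub_le_norm_sub_add_norm_sub w x z
    rw [norm_sub_rev x] at h8
    have h9 : ‖w - z‖ ^ 2 ≤ (‖w - x‖ + r) ^ 2 := by
      gcongr
      linarith
    have h10 : ‖w - x‖ * r ≤ W * r := by gcongr
    linarith
  have h8 : ρ * ‖z - x'‖ ^ 2 ≤ ρ * (4 * r) := by
    gcongr
    linarith
  have h9 : ρ * ‖w - z‖ ^ 2 ≤ ρ * (‖w - x‖ ^ 2 + (2 * W + 1) * r) := by gcongr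
  have h10 : ⟪v, w - x'⟫ = ⟪v, w - z⟫ + ⟪v, z - x'⟫ := by
    rw [← inner_add_right, sub_add_sub_cancel]
  rw [h10]
  linarith

/-- Estimates for one outer iteration of proximal random reshuffling started in a ball. -/
lemma IsPRRStep.exists_estimates (hg : ProperFn g) (hc : ConvexFn g) (hl : LocLipOnDom g)
    (hcl : IsClosed {x | g x ≠ ⊤}) (hDb : ∀ i, LocBounded (D i))
    (hDne : ∀ i x, (D i x).Nonempty) (hρ : 0 ≤ ρ)
    (hDdef : ∀ i x, D i x = WSubdiff (f i) ρ x) (R : ℝ) :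
    ∃ L ≥ (0 : ℝ), ∃ B ≥ (0 : ℝ), ∃ a > (0 : ℝ), ∀ α, 0 < α → α ≤ a →
      ∀ x x', x ∈ {x | g x ≠ ⊤} → ‖x‖ ≤ R → IsPRRStep N D g α x x' →
        x' ∈ {x | g x ≠ ⊤} ∧ ‖x' - x‖ ≤ L * α ∧ realPhi f g x - realPhi f g x' ≤ B * α ∧
        ∀ w ∈ {x | g x ≠ ⊤}, ‖w‖ ≤ R → ‖w - x'‖ ^ 2 ≤ (1 + 2 * (N * ρ) * α) * ‖w - x‖ ^ 2 +
          2 * α * (realPhi f g w - realPhi f g x') + B * α ^ 2 := by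
  obtain ⟨K, hK, hKg⟩ := exists_forall_sub_le_mul_norm hg hc hl hcl R
  choose b hb0 hb using fun i => (hDb i).exists_bound (R + 1)
  set B := ∑ i, b i
  have hB : 0 ≤ B := Finset.sum_nonneg fun i _ => hb0 i
  have hbB : ∀ i x, ‖x‖ ≤ R + 1 → ∀ v ∈ D i x, ‖v‖ ≤ B := fun i x hx v hv =>
    (hb i x hx v hv).trans (Finset.single_le_sum (fun i _ => hb0 i) (Finset.mem_univ i))
  have hsub : ∀ i x v, v ∈ D i x → ∀ y, f i x + ⟪v, y - x⟫ - ρ * ‖y - x‖ ^ 2 ≤ f i y :=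
    fun i x v hv y => by
      rw [hDdef] at hv
      exact hv y
  set L := K + N * B
  have hNB : 0 ≤ N * B := by positivity
  have hL : 0 ≤ L := by positivity
  set S := L * (4 * B + 5 * ρ + 4 * ρ * |R|)
  have hS : 0 ≤ S := by positivity
  refine ⟨L, hL, 2 * N * S + (K + N * (B + ρ)) * L, by positivity, 1 / (L + 1), by positivity,
    ?_⟩
  rintro α hα0 hαa x x' hx hxR ⟨σ, z, hz0, hz, hmin⟩
  have hLα : L * α ≤ 1 := by
    rw [le_div_iff₀ (by positivity)] at hαa
    linarith
  have hNBα : N * B * α ≤ L * α := by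
    have : N * B ≤ L := by simp only [L]; linarith
    gcongr
  choose v hvD hzv using hz
  have hzx : ∀ i ≤ N, ‖z i - x‖ ≤ i * B * α := by
    intro i
    induction i with
    | zero => simp [hz0]
    | succ i ih =>
      intro hi
      have h1 := ih (by omega)
      have hiN : (i : ℝ) ≤ N := by exact_mod_cast (by omega : i ≤ N)
      have h2 : i * B * α ≤ N * B * α := by gcongr
      have h3 : ‖z i‖ ≤ R + 1 := by
        have := norm_le_norm_add_norm_sub' (z i) x
        linarith
      have h4 := hbB _ _ h3 _ (hvD ⟨i, hi⟩)
      have h5 : ‖α • v ⟨i, hi⟩‖ ≤ α * B := by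
        rw [norm_smul, Real.norm_of_nonneg hα0.le]
        gcongr
      have h6 := hzv ⟨i, hi⟩
      simp only at h6
      rw [h6, sub_right_comm]
      refine (norm_sub_le _ _).trans ?_
      push_cast
      linarith
  have hzL : ∀ i ≤ N, ‖z i - x‖ ≤ L * α := fun i hi => by
    have hiN : (i : ℝ) ≤ N := by exact_mod_cast hi
    have h2 : i * B * α ≤ N * B * α := by gcongr
    linarith [hzx i hi]
  have hzR : ∀ i ≤ N, ‖z i‖ ≤ R + 1 := fun i hi => by
    have := norm_le_norm_add_norm_sub' (z i) x
    linarith [hzL i hi]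
  set V := ∑ i, v i
  have hVN : ‖V‖ ≤ N * B := by
    refine (norm_sum_le _ _).trans ?_
    have := Finset.sum_le_card_nsmul Finset.univ (fun i => ‖v i‖) B
      fun i _ => hbB _ _ (hzR i.1 i.2.le) _ (hvD i)
    simpa using this
  have hzN : z N = x - α • V := by
    have h1 := Finset.sum_range_sub z N
    rw [Finset.sum_range, Finset.sum_congr rfl (fun i _ => by rw [hzv i, sub_sub_cancel_left]),
      Finset.sum_neg_distrib, ← Finset.smul_sum, hz0] at h1
    rw [sub_eq_add_neg, h1]
    abel
  obtain ⟨hx', hmin'⟩ := toReal_add_le_of_forall_le hg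
    (q := fun w => ‖w - z N‖ ^ 2 / (2 * α)) hmin
  have hprox : ∀ w, g w ≠ ⊤ → ‖x' - x‖ ^ 2 + ‖w - x'‖ ^ 2 ≤
      2 * α * ((g w).toReal - (g x').toReal) + ‖w - x‖ ^ 2 + 2 * α * ⟪V, w - x'⟫ := by
    intro w hw
    have h1 := prox_quadratic_growth (μ := 0) hα0
      (by simpa using hc.convexOn_toReal hg) hx' hmin' hw
    have h2 : ∀ y, ‖y - z N‖ ^ 2 = ‖y - x‖ ^ 2 + 2 * (α * ⟪V, y - x⟫) + ‖α • V‖ ^ 2 := by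
      intro y
      rw [hzN, ← sub_add, norm_add_sq_real, inner_smul_right, real_inner_comm]
    rw [h2, h2] at h1
    have h3 : ⟪V, w - x'⟫ = ⟪V, w - x⟫ - ⟪V, x' - x⟫ := by
      rw [← inner_sub_right, sub_sub_sub_cancel_right]
    rw [h3]
    linarith
  have hxx' : ‖x' - x‖ ≤ L * α := by
    have h1 := hprox x hx
    have h2 := hKg x hx hxR x' hx'
    have h3 := real_inner_le_norm V (x - x')
    have h4 : ‖V‖ * ‖x - x'‖ ≤ N * B * ‖x - x'‖ := by gcongr
    rw [sub_self, norm_zero] at h1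
    rw [norm_sub_rev x' x] at h1 ⊢
    have h5 : α * ((g x).toReal - (g x').toReal + ⟪V, x - x'⟫) ≤ α * (L * ‖x - x'‖) := by
      gcongr
      simp only [L]
      linarith
    by_contra! hlt
    have : 0 ≤ L * α := by positivity
    nlinarith
  have hx'R : ‖x'‖ ≤ R + 1 := by
    have := norm_le_norm_add_norm_sub' x' x
    linarith
  refine ⟨hx', hxx', ?_, fun w hw hwR => ?_⟩
  · have h1 := hKg x hx hxR x' hx'
    have h2 : ∀ i, f i x - f i x' ≤ (B + ρ) * ‖x' - x‖ := fun i => by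
      obtain ⟨u, hu⟩ := hDne i x
      have h3 := hsub i x u hu x'
      have h4 := hbB i x (by linarith) u hu
      have h5 := neg_le_of_abs_le (abs_real_inner_le_norm u (x' - x))
      have h6 : ‖u‖ * ‖x' - x‖ ≤ B * ‖x' - x‖ := by gcongr
      have h7 : ρ * ‖x' - x‖ ^ 2 ≤ ρ * ‖x' - x‖ := by
        have : ‖x' - x‖ ^ 2 ≤ ‖x' - x‖ := by nlinarith [norm_nonneg (x' - x)]
        gcongr
      linarith
    have h3 : ∑ i, f i x - ∑ i, f i x' ≤ N * ((B + ρ) * ‖x' - x‖) := by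
      rw [← Finset.sum_sub_distrib]
      simpa using Finset.sum_le_card_nsmul Finset.univ _ _ fun i _ => h2 i
    rw [norm_sub_rev] at h1
    have h4 : (K + N * (B + ρ)) * ‖x' - x‖ ≤ (K + N * (B + ρ)) * (L * α) := by gcongr
    have h5 : 0 ≤ 2 * N * S * α := by positivity
    simp only [realPhi]
    linarith
  · have hwx : ‖w - x‖ ≤ 2 * |R| := by
      have := norm_sub_le w x
      have := le_abs_self R
      linarith
    have hinner : ∀ i, ⟪v i, w - x'⟫ ≤
        f (σ i) w - f (σ i) x' + (ρ * ‖w - x‖ ^ 2 + α * S) := fun i => by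
      obtain ⟨u, hu⟩ := hDne (σ i) x'
      have h1 := inner_sub_le_of_mem_WSubdiff hρ (hDdef _ _ ▸ hvD i) (hDdef _ _ ▸ hu)
        (hbB _ _ (hzR i.1 i.2.le) _ (hvD i)) (hbB _ _ hx'R u hu) hLα (hzL i.1 i.2.le) hxx' hwx
      simp only [S]
      linarith
    have hsum : ⟪V, w - x'⟫ ≤
        ∑ i, f i w - ∑ i, f i x' + N * (ρ * ‖w - x‖ ^ 2 + α * S) := by
      rw [sum_inner]
      refine (Finset.sum_le_sum fun i _ => hinner i).trans (le_of_eq ?_)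
      rw [Finset.sum_add_distrib, Finset.sum_sub_distrib, Equiv.sum_comp σ fun i => f i w,
        Equiv.sum_comp σ fun i => f i x']
      simp only [Finset.sum_const, Finset.card_univ, Fintype.card_fin, nsmul_eq_mul]
    have h1 := hprox w hw
    have h2 := mul_le_mul_of_nonneg_left hsum (by positivity : 0 ≤ 2 * α)
    have h3 : 0 ≤ (K + N * (B + ρ)) * L * α ^ 2 := by positivity
    have h4 : 0 ≤ ‖x' - x‖ ^ 2 := by positivity
    simp only [realPhi]
    linarith

end Reshuffling

/-- under the standing assumptions, with `f_i` `ρ`-weakly convex,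
`D_i = ∂f_i`, and `Φ` weakly convex, proximal random reshuffling with small
summable step sizes adding up to a large enough `T` converges to an
`(ε,δ)`-near approximate `D_Φ`-stationary point. -/
theorem stmt11 {d N : ℕ} (hN : 1 ≤ N) (f : Fin N → Euc d → ℝ)
    (D : Fin N → Euc d → Set (Euc d)) (g : Euc d → EReal)
    (hSA : StandingAssumptions N f D g)
    (ρ : ℝ) (hρ : 0 ≤ ρ)
    (hwc : ∀ i, ConvexOn ℝ Set.univ (fun x : Euc d => f i x + ρ * ‖x‖ ^ 2))
    (hDdef : ∀ i x, D i x = WSubdiff (f i) ρ x)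
    (hΦwc : ∃ ρ' ≥ (0:ℝ),
      ConvexFn (fun x : Euc d => Phi N f g x + ((ρ' * ‖x‖ ^ 2 : ℝ) : EReal)))
    (δ ε : ℝ) (hδ : 0 < δ) (hε : 0 < ε) :
    ∀ x₀ : Euc d, Phi N f g x₀ ≠ ⊤ →
      ∃ T₀ ≥ (0:ℝ), ∀ T ≥ T₀, ∃ αbar > (0:ℝ), ∀ (α : ℕ → ℝ) (xs : ℕ → Euc d),
        IsPRR N D g α xs → xs 0 = x₀ → (∀ k, 0 < α k ∧ α k ≤ αbar) →
        HasSum α T →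
        ∃ xstar : Euc d, Filter.Tendsto xs Filter.atTop (nhds xstar) ∧
          EMetric.infEdist (0 : Euc d)
              {v : Euc d | ∃ y : Euc d, ‖y - xstar‖ ≤ ε ∧ v ∈ DPhi N D g y} ≤
            ENNReal.ofReal δ := by
  obtain ⟨hfl, -, hDb, hDnc, hg, hgc, hcl, hll, c, hcb⟩ := hSA
  intro x₀ hx₀
  have hfc : ∀ i, Continuous (f i) := fun i => (hfl i).continuous
  have hx₀C : x₀ ∈ {x | g x ≠ ⊤} := fun h => hx₀ (by simp [Phi, h])
  have hμ : 0 ≤ N * ρ := by positivity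
  have hFc : ContinuousOn (realPhi f g) {x | g x ≠ ⊤} :=
    (continuous_finsetSum _ fun i _ => hfc i).continuousOn.add hll.continuousOn_toReal
  have hc : ∀ x ∈ {x | g x ≠ ⊤}, c ≤ realPhi f g x := fun x hx => by
    have h1 := hcb x
    rw [Phi, ← hg.coe_toReal hx] at h1
    exact_mod_cast h1
  have hF := convexOn_realPhi_add hg hgc hwc
  have hM : ∀ R : ℝ, ∃ M, ∀ x ∈ {x | g x ≠ ⊤}, ‖x‖ ≤ R → |realPhi f g x| ≤ M := fun R => by
    obtain ⟨M, hM⟩ :=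
      ((isCompact_closedBall (0 : Euc d) R).inter_left hcl).exists_bound_of_continuousOn
        (hFc.mono Set.inter_subset_left)
    exact ⟨M, fun x hx hxR => hM x ⟨hx, by simpa using hxR⟩⟩
  obtain ⟨X, hX0, hX⟩ := exists_evi_curve hcl hμ hF hFc hc hx₀C
  obtain ⟨h, hh, hμh⟩ : ∃ h > 0, 4 * (N * ρ) * h ≤ 1 := by
    refine ⟨1 / (4 * (N * ρ) + 1), by positivity, ?_⟩
    rw [mul_one_div, div_le_one (by positivity)]
    linarith
  obtain ⟨T₀, hT₀, hprox⟩ := hX.exists_forall_prox_displacement_le hμ hc hh hμh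
    (r := min (h * δ) (ε / 2)) (by positivity)
  refine ⟨T₀, hT₀, fun T hT => ?_⟩
  obtain ⟨αbar, hαbar, hlim⟩ := hX.exists_tendsto_near hμ hc hM
    (IsPRRStep.exists_estimates hg hgc hll hcl hDb (fun i x => (hDnc i x).1) hρ hDdef) T
    (half_pos hε)
  refine ⟨αbar, hαbar, fun α xs hxs hxs0 hα hsum => ?_⟩
  obtain ⟨xstar, hxstar, hnear⟩ := hlim α xs hxs (hxs0.trans hX0.symm) hα hsum
  refine ⟨xstar, hxstar, ?_⟩
  obtain ⟨y, hy, hyw⟩ := exists_prox hcl hh hF hFc hc (hX.mem T (hT₀.trans hT))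
  have hyT := hprox T hT y hy hyw
  have hmem := smul_sub_mem_DPhi hg hgc hfc hwc hDdef hh hy hyw
  have hyx : ‖y - xstar‖ ≤ ε := by
    have h1 := norm_sub_le_norm_sub_add_norm_sub y (X T) xstar
    rw [norm_sub_rev (X T)] at h1
    linarith [hyT.trans (min_le_right _ _)]
  have hmem' : h⁻¹ • (X T - y) ∈ {v : Euc d | ∃ y : Euc d, ‖y - xstar‖ ≤ ε ∧ v ∈ DPhi N D g y} :=
    ⟨y, hyx, hmem⟩
  refine (Metric.infEDist_le_edist_of_mem hmem').trans ?_
  rw [edist_dist, dist_zero_left, norm_smul, norm_inv, Real.norm_of_nonneg hh.le, norm_sub_rev]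
  exact ENNReal.ofReal_le_ofReal ((inv_mul_le_iff₀ hh).2 (hyT.trans (min_le_left _ _)))
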